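/- Let R(0), R(1) : Ω → ℛ be potential remotely sensed variables and set R := Y·R(1) + (1 − Y)·R(0), i.e. R = R(Y) pointwise for the binary outcome Y. Suppose: (Randomized sample selection) S is independent of the quadruple (Y(0), Y(1), R(0), R(1)); (Randomized treatment in the experiment) under P(·|S = e), D is independent of (Y(0), Y(1), R(0), R(1)); (Observational sample untreated) P(D = 0 | S = o) = 1; and P(S = e) > 0, P(S = o) > 0, P(D = 0, S = e) > 0. Then the joint law of the pair (Y, R) under P(·|D = 0, S = e) equals the joint law of (Y, R) under P(·|D = 0, S = o); consequently, E[h(Y, R) | D = 0, S = e] = E[h(Y, R) | D = 0, S = o] for every bounded measurable h : {0, 1} × ℛ → ℝ. In particular, random assignment of units into the experimental and observational samples does not remove the bias of the common practice, since the hypotheses of the bias formula remain satisfied. -/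

import Mathlib

open MeasureTheory ProbabilityTheory

noncomputable section

/-- Sample indicator values: experimental (`e`) or observational (`o`). -/
inductive Sample : Type
  | e
  | o
deriving DecidableEq

instance : MeasurableSpace Sample := ⊤

/-- Real-valued indicator of a boolean (`{0,1}`-valued variable). -/
def b2r (b : Bool) : ℝ := if b then 1 else 0

/-- `CondIndepOf P R V W` : the conditional law of `R` given `V = v, W = w` agrees with
the conditional law of `R` given `V = v`, for all values with positive probability;
this is the notion of "R is conditionally independent of W given V" for variables with
countable ranges. -/
def CondIndepOf {Ω 𝓡 V W : Type*} [MeasurableSpace Ω] [MeasurableSpace 𝓡]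
    (P : Measure Ω) (R : Ω → 𝓡) (Vf : Ω → V) (Wf : Ω → W) : Prop :=
  ∀ v w, 0 < P {ω | Vf ω = v ∧ Wf ω = w} →
    (P[|{ω | Vf ω = v ∧ Wf ω = w}]).map R = (P[|{ω | Vf ω = v}]).map R

/-- Conditioning on an event of an independent variable does not change a law. -/
theorem map_cond_preimage_of_indepFun {Ω α β : Type*} [MeasurableSpace Ω] [MeasurableSpace α]
    [MeasurableSpace β] {μ : Measure Ω} [IsFiniteMeasure μ] {X : Ω → α} {Z : Ω → β}
    (hX : Measurable X) (hZ : Measurable Z) (hXZ : IndepFun X Z μ) {s : Set α}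
    (hs : MeasurableSet s) (hpos : μ (X ⁻¹' s) ≠ 0) :
    (μ[|X ⁻¹' s]).map Z = μ.map Z := by
  ext t ht
  rw [Measure.map_apply hZ ht, Measure.map_apply hZ ht, cond_apply (hX hs),
    hXZ.measure_inter_preimage_eq_mul s t hs ht, ← mul_assoc,
    ENNReal.inv_mul_cancel hpos (measure_ne_top μ _), one_mul]

/-- Conditioning on an event of full measure leaves a probability measure unchanged. -/
theorem cond_eq_self_of_measure_eq_one {Ω : Type*} [MeasurableSpace Ω] {μ : Measure Ω}
    [IsProbabilityMeasure μ] {s : Set Ω} (hs : MeasurableSet s) (h : μ s = 1) :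
    μ[|s] = μ := by
  have hae : ∀ᵐ ω ∂μ, ω ∈ s := (prob_compl_eq_zero_iff hs).2 h
  rw [ProbabilityTheory.cond, h, inv_one, one_smul, Measure.restrict_eq_self_of_ae_mem hae]

/-- **Proposition (Bias with random sample selection).**
Under randomized sample selection and randomized treatment in the experiment, with an
untreated observational sample, the joint law of `(Y, R)` given `D = 0` is the same in
the experimental and observational samples; in particular the expectations of every
bounded measurable `h(Y, R)` agree across the two samples given `D = 0`. -/
theorem statement8
    {Ω 𝓡 : Type*} [MeasurableSpace Ω] [MeasurableSpace 𝓡] [StandardBorelSpace 𝓡]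
    (P : Measure Ω) [IsProbabilityMeasure P]
    (S : Ω → Sample) (D : Ω → Bool) (Y0 Y1 : Ω → Bool) (R0 R1 : Ω → 𝓡)
    (hS : Measurable S) (hD : Measurable D) (hY0 : Measurable Y0) (hY1 : Measurable Y1)
    (hR0 : Measurable R0) (hR1 : Measurable R1)
    (Y : Ω → Bool) (hYdef : ∀ ω, Y ω = if D ω then Y1 ω else Y0 ω)
    -- SUTVA for the RSV: R := Y·R(1) + (1 − Y)·R(0)
    (R : Ω → 𝓡) (hRdef : ∀ ω, R ω = if Y ω then R1 ω else R0 ω)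
    -- Randomized sample selection: S ⫫ (Y(0), Y(1), R(0), R(1))
    (sampleSelection : IndepFun S (fun ω => (Y0 ω, Y1 ω, R0 ω, R1 ω)) P)
    -- Randomized treatment in the experiment: D ⫫ (Y(0), Y(1), R(0), R(1)) | S = e
    (randomization : IndepFun D (fun ω => (Y0 ω, Y1 ω, R0 ω, R1 ω))
      (P[|{ω | S ω = Sample.e}]))
    -- Observational sample untreated: P(D = 0 | S = o) = 1
    (untreated_o : (P[|{ω | S ω = Sample.o}]) {ω | D ω = false} = 1)
    (hpos_e : 0 < P {ω | S ω = Sample.e})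
    (hpos_o : 0 < P {ω | S ω = Sample.o})
    (hpos_De : 0 < P {ω | D ω = false ∧ S ω = Sample.e}) :
    (P[|{ω | D ω = false ∧ S ω = Sample.e}]).map (fun ω => (Y ω, R ω)) =
        (P[|{ω | D ω = false ∧ S ω = Sample.o}]).map (fun ω => (Y ω, R ω)) ∧
      ∀ h : Bool × 𝓡 → ℝ, Measurable h → (∃ C : ℝ, ∀ p, |h p| ≤ C) →
        (∫ ω, h (Y ω, R ω) ∂(P[|{ω | D ω = false ∧ S ω = Sample.e}])) =
          (∫ ω, h (Y ω, R ω) ∂(P[|{ω | D ω = false ∧ S ω = Sample.o}])) := by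
  set Z : Ω → Bool × Bool × 𝓡 × 𝓡 := fun ω => (Y0 ω, Y1 ω, R0 ω, R1 ω)
  have hZ : Measurable Z := by fun_prop
  have hSm : ∀ s, MeasurableSet {ω | S ω = s} := fun s =>
    hS (MeasurableSpace.measurableSet_top (s := {s}))
  have hDm : MeasurableSet {ω | D ω = false} := hD (measurableSet_singleton false)
  have hinter : ∀ s, {ω | D ω = false ∧ S ω = s} = {ω | S ω = s} ∩ {ω | D ω = false} := by
    intro s
    ext ω
    exact and_comm
  have hcond : ∀ s, P[|{ω | D ω = false ∧ S ω = s}]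
      = (P[|{ω | S ω = s}])[|{ω | D ω = false}] := by
    intro s
    rw [hinter s, cond_cond_eq_cond_inter (hSm s) hDm]
  have hselect : ∀ s, 0 < P {ω | S ω = s} → (P[|{ω | S ω = s}]).map Z = P.map Z :=
    fun s hs => map_cond_preimage_of_indepFun (s := {s}) hS hZ sampleSelection
      MeasurableSpace.measurableSet_top hs.ne'
  have he : (P[|{ω | D ω = false ∧ S ω = Sample.e}]).map Z = P.map Z := by
    rw [← hselect Sample.e hpos_e, hcond]
    refine map_cond_preimage_of_indepFun (s := {false}) hD hZ randomization
      (measurableSet_singleton false) ?_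
    change (P[|{ω | S ω = Sample.e}]) {ω | D ω = false} ≠ 0
    rw [cond_apply (hSm _), ← hinter]
    exact mul_ne_zero (ENNReal.inv_ne_zero.2 (measure_ne_top P _)) hpos_De.ne'
  have ho : (P[|{ω | D ω = false ∧ S ω = Sample.o}]).map Z = P.map Z := by
    have := cond_isProbabilityMeasure hpos_o.ne'
    rw [← hselect Sample.o hpos_o, hcond, cond_eq_self_of_measure_eq_one hDm untreated_o]
  let f : Bool × Bool × 𝓡 × 𝓡 → Bool × 𝓡 := fun z =>
    (z.1, if z.1 = true then z.2.2.2 else z.2.2.1)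
  have hf : Measurable f :=
    measurable_fst.prodMk (Measurable.ite (measurable_fst (measurableSet_singleton true))
      (by fun_prop) (by fun_prop))
  have hYR : ∀ s, (P[|{ω | D ω = false ∧ S ω = s}]).map (fun ω => (Y ω, R ω))
      = ((P[|{ω | D ω = false ∧ S ω = s}]).map Z).map f := by
    intro s
    rw [Measure.map_map hf hZ]
    refine Measure.map_congr ?_
    filter_upwards [ae_cond_mem (hinter s ▸ (hSm s).inter hDm)] with ω hω
    simp [f, Z, hRdef, hYdef, hω.1]
  have hlaw : (P[|{ω | D ω = false ∧ S ω = Sample.e}]).map (fun ω => (Y ω, R ω))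
      = (P[|{ω | D ω = false ∧ S ω = Sample.o}]).map (fun ω => (Y ω, R ω)) := by
    rw [hYR, hYR, he, ho]
  refine ⟨hlaw, fun h hh _ => ?_⟩
  have hY : Measurable Y := by
    rw [funext hYdef]
    exact Measurable.ite (hD (measurableSet_singleton true)) hY1 hY0
  have hR : Measurable R := by
    rw [funext hRdef]
    exact Measurable.ite (hY (measurableSet_singleton true)) hR1 hR0
  rw [← integral_map (hY.prodMk hR).aemeasurable hh.aestronglyMeasurable, hlaw,
    integral_map (hY.prodMk hR).aemeasurable hh.aestronglyMeasurable]
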